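/- Let ρ > 0, l ∈ ℕ, N ∈ ℕ, let S, R ∈ ℝ^{l×l} be symmetric positive definite, and let z : [0,1] × [0,∞) → ℝ^l be continuously differentiable, satisfy the transport equation z_t(x,t) = −ρ z_x(x,t) for all (x,t) ∈ [0,1] × [0,∞), and have zero initial condition z(x,0) = 0 for all x ∈ [0,1]. Define Ω_k(t) = ∫₀¹ z(x,t) 𝓛_k(x) dx. Then the combined finite-horizon IQC holds: for every T ≥ 0, ρ ∫₀^T ( z(0,t)ᵀ S z(0,t) − z(1,t)ᵀ S z(1,t) ) dt + ∫₀^T ( z(0,t)ᵀ R z(0,t) − Σ_{k=0}^{N} (2k+1) Ω_k(t)ᵀ R Ω_k(t) ) dt − Σ_{k=0}^{N} (2k+1) Ω_k(T)ᵀ S Ω_k(T) ≥ 0. -/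

import Mathlib

open Finset Matrix

/-- The shifted Legendre polynomial on `[0,1]`:
`𝓛_k(x) = (−1)^k ∑_{l=0}^{k} (−1)^l (k choose l) ((k+l) choose l) x^l`. -/
noncomputable def shiftedLegendre (k : ℕ) (x : ℝ) : ℝ :=
  (-1 : ℝ) ^ k *
    ∑ l ∈ range (k + 1),
      (-1 : ℝ) ^ l * (k.choose l) * ((k + l).choose l) * x ^ l

section

open scoped Polynomial Nat
open Polynomial (derivative C X)

/-- Integration by parts on `[0,1]` for polynomials whose product vanishes at both endpoints. -/
lemma integral_eval_mul_derivative (p q : ℝ[X]) (h0 : (p * q).eval 0 = 0)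
    (h1 : (p * q).eval 1 = 0) :
    ∫ x in (0 : ℝ)..1, p.eval x * (derivative q).eval x =
      -∫ x in (0 : ℝ)..1, (derivative p).eval x * q.eval x := by
  rw [intervalIntegral.integral_mul_deriv_eq_deriv_mul (fun x _ => p.hasDerivAt x)
    (fun x _ => q.hasDerivAt x) ((derivative p).continuous.intervalIntegrable _ _)
    ((derivative q).continuous.intervalIntegrable _ _)]
  rw [Polynomial.eval_mul] at h0 h1
  rw [h0, h1]
  ring

/-- The polynomial weight `X ^ n * (1 - X) ^ n` in Rodrigues' formula. -/
noncomputable def rodriguesWeight (n : ℕ) : ℝ[X] := X ^ n * (1 - X) ^ n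

lemma eval_zero_iterate_derivative_rodriguesWeight {n i : ℕ} (h : i < n) :
    (derivative^[i] (rodriguesWeight n)).eval 0 = 0 := by
  obtain ⟨r, hr⟩ := Polynomial.pow_sub_dvd_iterate_derivative_of_pow_dvd i
    (show X ^ n ∣ rodriguesWeight n from Dvd.intro _ rfl)
  rw [hr]
  simp [Nat.sub_ne_zero_of_lt h]

lemma eval_one_iterate_derivative_rodriguesWeight {n i : ℕ} (h : i < n) :
    (derivative^[i] (rodriguesWeight n)).eval 1 = 0 := by
  obtain ⟨r, hr⟩ := Polynomial.pow_sub_dvd_iterate_derivative_of_pow_dvd i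
    (show (1 - X) ^ n ∣ rodriguesWeight n from Dvd.intro_left _ rfl)
  rw [hr]
  simp [Nat.sub_ne_zero_of_lt h]

lemma integral_eval_mul_iterate_derivative_rodriguesWeight (n : ℕ) {j : ℕ} (hj : j ≤ n)
    (p : ℝ[X]) :
    ∫ x in (0 : ℝ)..1, p.eval x * (derivative^[j] (rodriguesWeight n)).eval x =
      (-1) ^ j * ∫ x in (0 : ℝ)..1, (derivative^[j] p).eval x * (rodriguesWeight n).eval x := by
  induction j generalizing p with
  | zero => simp
  | succ j ih =>
    rw [Function.iterate_succ_apply', integral_eval_mul_derivative, ih (by omega),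
      Function.iterate_succ_apply]
    · ring
    · simp [eval_zero_iterate_derivative_rodriguesWeight hj]
    · simp [eval_one_iterate_derivative_rodriguesWeight hj]

/-- Euler's beta integral at natural numbers. -/
lemma integral_pow_mul_one_sub_pow (a b : ℕ) :
    ((a + b + 1)! : ℝ) * ∫ x in (0 : ℝ)..1, x ^ a * (1 - x) ^ b = a ! * b ! := by
  induction b generalizing a with
  | zero => simp [Nat.factorial_succ]; field_simp
  | succ b ih =>
    have key := integral_eval_mul_derivative ((1 - X) ^ (b + 1)) (X ^ (a + 1)) (by simp) (by simp)
    have e1 : ∀ x : ℝ, ((1 - X : ℝ[X]) ^ (b + 1)).eval x *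
        (derivative (X ^ (a + 1) : ℝ[X])).eval x = (a + 1) * (x ^ a * (1 - x) ^ (b + 1)) := by
      intro x
      simp [Polynomial.derivative_pow]
      ring
    have e2 : ∀ x : ℝ, (derivative ((1 - X : ℝ[X]) ^ (b + 1))).eval x *
        (X ^ (a + 1) : ℝ[X]).eval x = -(b + 1) * (x ^ (a + 1) * (1 - x) ^ b) := by
      intro x
      simp [Polynomial.derivative_pow]
      ring
    simp only [e1, e2, intervalIntegral.integral_const_mul] at key
    have := ih (a + 1)
    rw [show a + 1 + b + 1 = a + (b + 1) + 1 by ring] at this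
    have ha : (a + 1 : ℝ) ≠ 0 := by positivity
    apply mul_left_cancel₀ ha
    rw [Nat.factorial_succ a] at this
    rw [Nat.factorial_succ b]
    push_cast at this ⊢
    linear_combination ((a + (b + 1) + 1)! : ℝ) * key + (b + 1) * this

/-- The real shifted Legendre polynomial, in Mathlib's normalization of the sign. -/
noncomputable def realShiftedLegendre (n : ℕ) : ℝ[X] :=
  (Polynomial.shiftedLegendre n).map (Int.castRingHom ℝ)

lemma shiftedLegendre_eq_eval (k : ℕ) (x : ℝ) :
    shiftedLegendre k x = (-1) ^ k * (realShiftedLegendre k).eval x := by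
  simp only [shiftedLegendre, realShiftedLegendre, Polynomial.shiftedLegendre,
    Polynomial.map_sum, Polynomial.eval_finsetSum]
  congr 1
  refine sum_congr rfl fun l _ => ?_
  simp [show (k + l).choose l = (k + l).choose k from Nat.choose_symm_add.symm]

lemma factorial_mul_realShiftedLegendre (n : ℕ) :
    C (n ! : ℝ) * realShiftedLegendre n = derivative^[n] (rodriguesWeight n) := by
  have h := congrArg (Polynomial.map (Int.castRingHom ℝ))
    (Polynomial.factorial_mul_shiftedLegendre_eq n)
  rw [← Polynomial.iterate_derivative_map] at h
  simpa [realShiftedLegendre, rodriguesWeight] using h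

lemma factorial_mul_integral_mul_realShiftedLegendre (n : ℕ) (p : ℝ[X]) :
    (n ! : ℝ) * ∫ x in (0 : ℝ)..1, p.eval x * (realShiftedLegendre n).eval x =
      (-1) ^ n * ∫ x in (0 : ℝ)..1, (derivative^[n] p).eval x * (rodriguesWeight n).eval x := by
  rw [← integral_eval_mul_iterate_derivative_rodriguesWeight n le_rfl,
    ← factorial_mul_realShiftedLegendre, ← intervalIntegral.integral_const_mul]
  congr 1
  ext x
  simp
  ring

lemma natDegree_realShiftedLegendre_le (n : ℕ) : (realShiftedLegendre n).natDegree ≤ n :=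
  Polynomial.natDegree_map_le.trans (Polynomial.natDegree_shiftedLegendre n).le

lemma integral_realShiftedLegendre_mul_of_lt {m n : ℕ} (h : m < n) :
    ∫ x in (0 : ℝ)..1, (realShiftedLegendre m).eval x * (realShiftedLegendre n).eval x = 0 := by
  have := factorial_mul_integral_mul_realShiftedLegendre n (realShiftedLegendre m)
  rw [Polynomial.iterate_derivative_eq_zero
    ((natDegree_realShiftedLegendre_le m).trans_lt h)] at this
  simpa [Nat.factorial_ne_zero] using this

lemma iterate_derivative_realShiftedLegendre_self (n : ℕ) :
    derivative^[n] (realShiftedLegendre n) = C ((-1) ^ n * (n ! : ℝ) * (n + n).choose n) := by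
  ext m
  rw [Polynomial.coeff_iterate_derivative, Polynomial.coeff_C]
  rcases Nat.eq_zero_or_pos m with rfl | hm
  · simp [realShiftedLegendre, Polynomial.coeff_shiftedLegendre, Nat.descFactorial_self]
    ring
  · rw [Polynomial.coeff_eq_zero_of_natDegree_lt
      ((natDegree_realShiftedLegendre_le n).trans_lt (by omega)), if_neg hm.ne', smul_zero]

lemma integral_realShiftedLegendre_sq (n : ℕ) :
    ∫ x in (0 : ℝ)..1, (realShiftedLegendre n).eval x * (realShiftedLegendre n).eval x =
      1 / (2 * n + 1) := by
  have h := factorial_mul_integral_mul_realShiftedLegendre n (realShiftedLegendre n)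
  have hb := integral_pow_mul_one_sub_pow n n
  have hc : ((n + n).choose n : ℝ) * n ! * n ! = (n + n)! := by
    exact_mod_cast Nat.add_choose_mul_factorial_mul_factorial n n
  have hs : ((-1 : ℝ) ^ n) * (-1) ^ n = 1 := by rw [← mul_pow]; simp
  rw [iterate_derivative_realShiftedLegendre_self] at h
  simp only [rodriguesWeight, Polynomial.eval_C, Polynomial.eval_mul, Polynomial.eval_pow,
    Polynomial.eval_X, Polynomial.eval_sub, Polynomial.eval_one,
    intervalIntegral.integral_const_mul] at h
  rw [Nat.factorial_succ] at hb
  push_cast at hb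
  have hn : (n ! : ℝ) ≠ 0 := by positivity
  rw [eq_div_iff (by positivity)]
  apply mul_left_cancel₀ hn
  apply mul_left_cancel₀ hn
  apply mul_left_cancel₀ hn
  set J := ∫ x in (0 : ℝ)..1, x ^ n * (1 - x) ^ n
  linear_combination (n ! : ℝ) * n ! * (2 * n + 1) * h +
    n ! * n ! * n ! * ((n + n).choose n) * (2 * n + 1) * J * hs +
    (2 * n + 1) * n ! * J * hc + n ! * hb

lemma continuous_shiftedLegendre (k : ℕ) : Continuous (shiftedLegendre k) := by
  unfold shiftedLegendre
  fun_prop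

/-- Orthogonality of the shifted Legendre polynomials in `L²(0,1)`. -/
lemma integral_shiftedLegendre_mul (j k : ℕ) :
    ∫ x in (0 : ℝ)..1, shiftedLegendre j x * shiftedLegendre k x =
      if j = k then 1 / (2 * (k : ℝ) + 1) else 0 := by
  have e : ∀ x, shiftedLegendre j x * shiftedLegendre k x = ((-1) ^ j * (-1) ^ k) *
      ((realShiftedLegendre j).eval x * (realShiftedLegendre k).eval x) := by
    intro x
    rw [shiftedLegendre_eq_eval, shiftedLegendre_eq_eval]
    ring
  simp only [e, intervalIntegral.integral_const_mul]
  rcases lt_trichotomy j k with h | rfl | h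
  · rw [integral_realShiftedLegendre_mul_of_lt h, if_neg h.ne, mul_zero]
  · rw [integral_realShiftedLegendre_sq, if_pos rfl, ← mul_pow]
    simp
  · simp_rw [mul_comm ((realShiftedLegendre j).eval _)]
    rw [integral_realShiftedLegendre_mul_of_lt h, if_neg h.ne', mul_zero]

end

/-- The truncated shifted Legendre expansion of `f`. -/
noncomputable def legendreProj (n : ℕ) (f : ℝ → ℝ) (x : ℝ) : ℝ :=
  ∑ k ∈ range n, (2 * (k : ℝ) + 1) * (∫ y in (0 : ℝ)..1, f y * shiftedLegendre k y) *
    shiftedLegendre k x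

lemma continuous_legendreProj (n : ℕ) (f : ℝ → ℝ) : Continuous (legendreProj n f) := by
  unfold legendreProj
  have := continuous_shiftedLegendre
  fun_prop

lemma integral_mul_sub_legendreProj (n : ℕ) {f h : ℝ → ℝ} (hf : Continuous f)
    (hh : Continuous h) :
    ∫ x in (0 : ℝ)..1, h x * (f x - legendreProj n f x) =
      (∫ x in (0 : ℝ)..1, h x * f x) - ∑ k ∈ range n, (2 * (k : ℝ) + 1) *
        (∫ x in (0 : ℝ)..1, f x * shiftedLegendre k x) *
          ∫ x in (0 : ℝ)..1, h x * shiftedLegendre k x := by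
  have hL := continuous_shiftedLegendre
  have hP := continuous_legendreProj n f
  simp_rw [mul_sub]
  rw [intervalIntegral.integral_sub ((hh.fun_mul hf).intervalIntegrable _ _)
    ((hh.fun_mul hP).intervalIntegrable _ _)]
  congr 1
  simp_rw [legendreProj, mul_sum]
  rw [intervalIntegral.integral_finsetSum fun k _ =>
    (hh.fun_mul (continuous_const.fun_mul (hL k))).intervalIntegrable _ _]
  refine sum_congr rfl fun k _ => ?_
  rw [← intervalIntegral.integral_const_mul (_ * _)]
  congr 1
  ext x
  ring

lemma integral_shiftedLegendre_mul_sub_legendreProj {n j : ℕ} (hj : j < n) {f : ℝ → ℝ}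
    (hf : Continuous f) :
    ∫ x in (0 : ℝ)..1, shiftedLegendre j x * (f x - legendreProj n f x) = 0 := by
  rw [integral_mul_sub_legendreProj n hf (continuous_shiftedLegendre j)]
  simp_rw [integral_shiftedLegendre_mul, mul_ite, mul_zero]
  rw [sum_ite_eq, if_pos (mem_range.2 hj)]
  have : (2 * (j : ℝ) + 1) ≠ 0 := by positivity
  simp_rw [mul_comm (shiftedLegendre j _)]
  field_simp
  ring

lemma integral_sub_legendreProj_mul_sub_legendreProj (n : ℕ) {f g : ℝ → ℝ}
    (hf : Continuous f) (hg : Continuous g) :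
    ∫ x in (0 : ℝ)..1, (f x - legendreProj n f x) * (g x - legendreProj n g x) =
      (∫ x in (0 : ℝ)..1, f x * g x) - ∑ k ∈ range n, (2 * (k : ℝ) + 1) *
        ((∫ x in (0 : ℝ)..1, f x * shiftedLegendre k x) *
          ∫ x in (0 : ℝ)..1, g x * shiftedLegendre k x) := by
  rw [integral_mul_sub_legendreProj n hg (hf.fun_sub (continuous_legendreProj n f))]
  rw [sum_eq_zero, sub_zero]
  · simp_rw [mul_comm (f _ - _)]
    rw [integral_mul_sub_legendreProj n hf hg]
    simp_rw [mul_comm (g _) (f _), mul_assoc]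
  · intro k hk
    simp_rw [mul_comm (f _ - _)]
    rw [integral_shiftedLegendre_mul_sub_legendreProj (mem_range.1 hk) hf, mul_zero]

lemma dotProduct_mulVec_eq_sum {ι : Type*} [Fintype ι] (M : Matrix ι ι ℝ) (u w : ι → ℝ) :
    u ⬝ᵥ M.mulVec w = ∑ i, ∑ j, M i j * (u i * w j) := by
  simp only [dotProduct, mulVec, mul_sum]
  exact sum_congr rfl fun i _ => sum_congr rfl fun j _ => by ring

/-- Bessel's inequality for shifted Legendre coefficients with a positive semidefinite weight. -/
lemma sum_legendre_coeff_le_integral {ι : Type*} [Fintype ι] (M : Matrix ι ι ℝ)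
    (hM : ∀ v : ι → ℝ, 0 ≤ v ⬝ᵥ M.mulVec v) (n : ℕ) {v : ℝ → ι → ℝ} (hv : Continuous v)
    (c : ℕ → ι → ℝ) (hc : ∀ k i, c k i = ∫ x in (0 : ℝ)..1, v x i * shiftedLegendre k x) :
    ∑ k ∈ range n, (2 * (k : ℝ) + 1) * (c k ⬝ᵥ M.mulVec (c k)) ≤
      ∫ x in (0 : ℝ)..1, v x ⬝ᵥ M.mulVec (v x) := by
  have hvi : ∀ i, Continuous fun x => v x i := fun i => (continuous_apply i).comp hv
  have hP : ∀ i, Continuous (legendreProj n fun x => v x i) := fun i =>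
    continuous_legendreProj _ _
  have hpos : 0 ≤ ∫ x in (0 : ℝ)..1,
      (fun i => v x i - legendreProj n (fun y => v y i) x) ⬝ᵥ
        M.mulVec fun i => v x i - legendreProj n (fun y => v y i) x :=
    intervalIntegral.integral_nonneg zero_le_one fun x _ => hM _
  have expand : ∀ u : ℝ → ι → ℝ, (∀ i, Continuous fun x => u x i) →
      ∫ x in (0 : ℝ)..1, u x ⬝ᵥ M.mulVec (u x) =
        ∑ i, ∑ j, M i j * ∫ x in (0 : ℝ)..1, u x i * u x j := by
    intro u hu
    simp_rw [dotProduct_mulVec_eq_sum]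
    rw [intervalIntegral.integral_finsetSum fun i _ =>
      Continuous.intervalIntegrable (by fun_prop) _ _]
    refine sum_congr rfl fun i _ => ?_
    rw [intervalIntegral.integral_finsetSum fun j _ =>
      Continuous.intervalIntegrable (by fun_prop) _ _]
    simp_rw [intervalIntegral.integral_const_mul]
  rw [expand _ fun i => (hvi i).fun_sub (hP i)] at hpos
  simp_rw [integral_sub_legendreProj_mul_sub_legendreProj n (hvi _) (hvi _), ← hc, mul_sub,
    sum_sub_distrib, ← expand v hvi] at hpos
  refine (sub_nonneg.1 hpos).trans' (le_of_eq ?_)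
  simp_rw [dotProduct_mulVec_eq_sum, mul_sum]
  rw [sum_comm]
  refine sum_congr rfl fun i _ => ?_
  rw [sum_comm]
  exact sum_congr rfl fun j _ => sum_congr rfl fun k _ => by ring

/-- Balance law for a scalar density `q` transported with velocity `ρ` on `[0, a] × [0, T]`. -/
lemma transport_flux_balance {ρ a T : ℝ} (ha : 0 ≤ a) (hT : 0 ≤ T)
    {q : ℝ × ℝ → ℝ} (hq : ContDiff ℝ 1 q)
    (hpde : ∀ x ∈ Set.Icc 0 a, ∀ t ∈ Set.Icc 0 T,
      fderiv ℝ q (x, t) (0, 1) = -ρ * fderiv ℝ q (x, t) (1, 0)) :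
    ρ * ((∫ t in (0 : ℝ)..T, q (0, t)) - ∫ t in (0 : ℝ)..T, q (a, t)) =
      (∫ x in (0 : ℝ)..a, q (x, T)) - ∫ x in (0 : ℝ)..a, q (x, 0) := by
  have hd : ∀ p, HasFDerivAt q (fderiv ℝ q p) p := fun p =>
    (hq.differentiable one_ne_zero p).hasFDerivAt
  have hcd : Continuous (fderiv ℝ q) := hq.continuous_fderiv one_ne_zero
  have key := MeasureTheory.integral2_divergence_prod_of_hasFDerivAt
    (fun p => ρ * q p) q (fun p => ρ • fderiv ℝ q p) (fderiv ℝ q) 0 0 a T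
    (by have := hq.continuous; fun_prop) hq.continuous.continuousOn
    (fun p _ => (hd p).const_mul ρ) (fun p _ => hd p)
    ((Continuous.continuousOn
      (by simp only [_root_.smul_apply]; fun_prop)).integrableOn_compact
      (isCompact_uIcc.prod isCompact_uIcc))
  have hzero : ∫ x in (0 : ℝ)..a, ∫ t in (0 : ℝ)..T,
      ((ρ • fderiv ℝ q (x, t)) (1, 0) + fderiv ℝ q (x, t) (0, 1)) = 0 := by
    refine intervalIntegral.integral_zero_ae (.of_forall fun x hx => ?_)
    refine intervalIntegral.integral_zero_ae (.of_forall fun t ht => ?_)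
    rw [Set.uIoc_of_le ha] at hx
    rw [Set.uIoc_of_le hT] at ht
    rw [hpde x ⟨hx.1.le, hx.2⟩ t ⟨ht.1.le, ht.2⟩]
    simp
  rw [hzero] at key
  simp only [intervalIntegral.integral_const_mul] at key
  linarith

/-- The quadratic density `zᵀ M z` of a solution of the transport equation is transported too. -/
lemma fderiv_quadratic_of_transport {ι : Type*} [Fintype ι] (M : Matrix ι ι ℝ) {ρ : ℝ}
    {z : ℝ × ℝ → ι → ℝ} {x t : ℝ} (hz : DifferentiableAt ℝ z (x, t))
    (hpde : deriv (fun s => z (x, s)) t = -ρ • deriv (fun y => z (y, t)) x) :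
    fderiv ℝ (fun p => z p ⬝ᵥ M.mulVec (z p)) (x, t) (0, 1) =
      -ρ * fderiv ℝ (fun p => z p ⬝ᵥ M.mulVec (z p)) (x, t) (1, 0) := by
  have ht : deriv (fun s => z (x, s)) t = fderiv ℝ z (x, t) (0, 1) :=
    (hz.hasFDerivAt.comp_hasDerivAt t ((hasDerivAt_const t x).prodMk (hasDerivAt_id t))).deriv
  have hx : deriv (fun y => z (y, t)) x = fderiv ℝ z (x, t) (1, 0) :=
    (hz.hasFDerivAt.comp_hasDerivAt x ((hasDerivAt_id x).prodMk (hasDerivAt_const x t))).deriv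
  rw [ht, hx] at hpde
  have hi : ∀ i, HasFDerivAt (fun p => z p i)
      ((ContinuousLinearMap.proj i).comp (fderiv ℝ z (x, t))) (x, t) :=
    hasFDerivAt_pi'.1 hz.hasFDerivAt
  have hq := HasFDerivAt.fun_sum (u := univ) fun i _ =>
    HasFDerivAt.fun_sum (u := univ) fun j _ => ((hi i).fun_mul (hi j)).const_mul (M i j)
  simp_rw [dotProduct_mulVec_eq_sum]
  rw [hq.fderiv]
  simp only [_root_.sum_apply, _root_.smul_apply,
    _root_.add_apply, ContinuousLinearMap.comp_apply, ContinuousLinearMap.proj_apply,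
    hpde, Pi.smul_apply, smul_eq_mul, mul_sum]
  exact sum_congr rfl fun i _ => sum_congr rfl fun j _ => by ring

/-- With zero initial data, what entered at `0` and has not left at `a` is stored in `[0, a]`. -/
lemma transport_quadratic_balance {ι : Type*} [Fintype ι] (M : Matrix ι ι ℝ) {ρ : ℝ}
    {z : ℝ × ℝ → ι → ℝ} (hz : ContDiff ℝ 1 z)
    (hpde : ∀ x ∈ Set.Icc (0:ℝ) 1, ∀ t ≥ (0:ℝ),
      deriv (fun s => z (x, s)) t = -ρ • deriv (fun y => z (y, t)) x)
    (hinit : ∀ x ∈ Set.Icc (0:ℝ) 1, z (x, 0) = 0) {a T : ℝ} (ha : a ∈ Set.Icc (0 : ℝ) 1)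
    (hT : 0 ≤ T) :
    ρ * ((∫ t in (0 : ℝ)..T, z (0, t) ⬝ᵥ M.mulVec (z (0, t))) -
        ∫ t in (0 : ℝ)..T, z (a, t) ⬝ᵥ M.mulVec (z (a, t))) =
      ∫ x in (0 : ℝ)..a, z (x, T) ⬝ᵥ M.mulVec (z (x, T)) := by
  have hq : ContDiff ℝ 1 fun p => z p ⬝ᵥ M.mulVec (z p) := by
    have := contDiff_pi.1 hz
    simp_rw [dotProduct_mulVec_eq_sum]
    fun_prop
  have hbal := transport_flux_balance ha.1 hT hq (fun x hx t ht =>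
    fderiv_quadratic_of_transport M (hz.differentiable one_ne_zero _)
      (hpde x ⟨hx.1, hx.2.trans ha.2⟩ t ht.1))
  have h0 : ∫ x in (0 : ℝ)..a, z (x, 0) ⬝ᵥ M.mulVec (z (x, 0)) = 0 := by
    refine intervalIntegral.integral_zero_ae (.of_forall fun x hx => ?_)
    rw [Set.uIoc_of_le ha.1] at hx
    simp [hinit x ⟨hx.1.le, hx.2.trans ha.2⟩]
  rw [hbal, h0, sub_zero]


/-- Combined finite-horizon IQC for the transport equation: for symmetric
positive definite `S, R` and `z` a solution of `z_t = −ρ z_x` on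
`[0,1] × [0,∞)` with zero initial condition, for every `T ≥ 0`,
`ρ ∫₀^T ( z(0,t)ᵀ S z(0,t) − z(1,t)ᵀ S z(1,t) ) dt
 + ∫₀^T ( z(0,t)ᵀ R z(0,t) − ∑_{k=0}^{N} (2k+1) Ω_k(t)ᵀ R Ω_k(t) ) dt
 − ∑_{k=0}^{N} (2k+1) Ω_k(T)ᵀ S Ω_k(T) ≥ 0`. -/
theorem transport_combined_IQC
    (ρ : ℝ) (hρ : 0 < ρ) (l N : ℕ)
    (S R : Matrix (Fin l) (Fin l) ℝ)
    (hSsymm : S.IsSymm) (hRsymm : R.IsSymm)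
    (hSpd : ∀ v : Fin l → ℝ, v ≠ 0 → 0 < v ⬝ᵥ S.mulVec v)
    (hRpd : ∀ v : Fin l → ℝ, v ≠ 0 → 0 < v ⬝ᵥ R.mulVec v)
    (z : ℝ × ℝ → Fin l → ℝ)
    (hz : ContDiff ℝ 1 z)
    (hpde : ∀ x ∈ Set.Icc (0:ℝ) 1, ∀ t ≥ (0:ℝ),
      deriv (fun s => z (x, s)) t = -ρ • deriv (fun y => z (y, t)) x)
    (hinit : ∀ x ∈ Set.Icc (0:ℝ) 1, z (x, 0) = 0)
    (Ω : ℕ → ℝ → Fin l → ℝ)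
    (hΩ : ∀ k t i, Ω k t i = ∫ x in (0:ℝ)..1, z (x, t) i * shiftedLegendre k x) :
    ∀ T ≥ (0:ℝ),
      ρ * (∫ t in (0:ℝ)..T,
          (z (0, t) ⬝ᵥ S.mulVec (z (0, t)) - z (1, t) ⬝ᵥ S.mulVec (z (1, t)))) +
        (∫ t in (0:ℝ)..T,
          (z (0, t) ⬝ᵥ R.mulVec (z (0, t)) -
            ∑ k ∈ range (N + 1), (2 * (k : ℝ) + 1) * (Ω k t ⬝ᵥ R.mulVec (Ω k t)))) -
        ∑ k ∈ range (N + 1), (2 * (k : ℝ) + 1) * (Ω k T ⬝ᵥ S.mulVec (Ω k T)) ≥ 0 := by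
  intro T hT
  have psd : ∀ M : Matrix (Fin l) (Fin l) ℝ, (∀ v : Fin l → ℝ, v ≠ 0 → 0 < v ⬝ᵥ M.mulVec v) →
      ∀ v : Fin l → ℝ, 0 ≤ v ⬝ᵥ M.mulVec v := by
    intro M hM v
    rcases eq_or_ne v 0 with rfl | hv
    · simp
    · exact (hM v hv).le
  have hzc : Continuous z := hz.continuous
  have hqc : ∀ M : Matrix (Fin l) (Fin l) ℝ, Continuous fun p => z p ⬝ᵥ M.mulVec (z p) :=
    fun M => hzc.dotProduct (continuous_const.matrix_mulVec hzc)
  have hqx : ∀ (M : Matrix (Fin l) (Fin l) ℝ) (x : ℝ),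
      Continuous fun t => z (x, t) ⬝ᵥ M.mulVec (z (x, t)) :=
    fun M x => (hqc M).comp (by fun_prop : Continuous fun t : ℝ => (x, t))
  have bessel : ∀ M : Matrix (Fin l) (Fin l) ℝ,
      (∀ v : Fin l → ℝ, v ≠ 0 → 0 < v ⬝ᵥ M.mulVec v) → ∀ t : ℝ,
      ∑ k ∈ range (N + 1), (2 * (k : ℝ) + 1) * (Ω k t ⬝ᵥ M.mulVec (Ω k t)) ≤
        ∫ x in (0 : ℝ)..1, z (x, t) ⬝ᵥ M.mulVec (z (x, t)) := fun M hM t =>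
    sum_legendre_coeff_le_integral M (psd M hM) (N + 1)
      (hzc.comp (by fun_prop : Continuous fun x : ℝ => (x, t))) (fun k => Ω k t)
      fun k i => hΩ k t i
  have hS : 0 ≤ ρ * (∫ t in (0:ℝ)..T,
      (z (0, t) ⬝ᵥ S.mulVec (z (0, t)) - z (1, t) ⬝ᵥ S.mulVec (z (1, t)))) -
      ∑ k ∈ range (N + 1), (2 * (k : ℝ) + 1) * (Ω k T ⬝ᵥ S.mulVec (Ω k T)) := by
    rw [intervalIntegral.integral_sub ((hqx S 0).intervalIntegrable _ _)
      ((hqx S 1).intervalIntegrable _ _),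
      transport_quadratic_balance S hz hpde hinit (Set.right_mem_Icc.2 zero_le_one) hT]
    exact sub_nonneg.2 (bessel S hSpd T)
  have hΩc : ∀ k, Continuous (Ω k) := by
    intro k
    refine continuous_pi fun i => ?_
    simp_rw [hΩ]
    have := continuous_shiftedLegendre k
    exact intervalIntegral.continuous_parametric_intervalIntegral_of_continuous'
      (f := fun t x => z (x, t) i * shiftedLegendre k x)
      (by unfold Function.uncurry; fun_prop) 0 1
  have hsum : Continuous fun t =>
      ∑ k ∈ range (N + 1), (2 * (k : ℝ) + 1) * (Ω k t ⬝ᵥ R.mulVec (Ω k t)) :=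
    continuous_finsetSum _ fun k _ => continuous_const.mul
      ((hΩc k).dotProduct (continuous_const.matrix_mulVec (hΩc k)))
  have hswap : Continuous (Function.uncurry fun t x : ℝ => z (x, t) ⬝ᵥ R.mulVec (z (x, t))) :=
    (hqc R).comp continuous_swap
  have hswap' : Continuous (Function.uncurry fun x t : ℝ => z (x, t) ⬝ᵥ R.mulVec (z (x, t))) :=
    hqc R
  have hR : 0 ≤ ∫ t in (0:ℝ)..T, (z (0, t) ⬝ᵥ R.mulVec (z (0, t)) -
      ∑ k ∈ range (N + 1), (2 * (k : ℝ) + 1) * (Ω k t ⬝ᵥ R.mulVec (Ω k t))) := by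
    rw [intervalIntegral.integral_sub ((hqx R 0).intervalIntegrable _ _)
      (hsum.intervalIntegrable _ _), sub_nonneg]
    calc ∫ t in (0:ℝ)..T, ∑ k ∈ range (N + 1), (2 * (k : ℝ) + 1) * (Ω k t ⬝ᵥ R.mulVec (Ω k t))
        ≤ ∫ t in (0:ℝ)..T, ∫ x in (0:ℝ)..1, z (x, t) ⬝ᵥ R.mulVec (z (x, t)) :=
          intervalIntegral.integral_mono_on hT (hsum.intervalIntegrable _ _)
            ((intervalIntegral.continuous_parametric_intervalIntegral_of_continuous'
              hswap 0 1).intervalIntegrable _ _) fun t _ => bessel R hRpd t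
      _ = ∫ x in (0:ℝ)..1, ∫ t in (0:ℝ)..T, z (x, t) ⬝ᵥ R.mulVec (z (x, t)) :=
          MeasureTheory.intervalIntegral_intervalIntegral_swap
            ((hswap.continuousOn.integrableOn_compact
              (isCompact_uIcc.prod isCompact_uIcc)).mono_set
                (Set.prod_mono Set.uIoc_subset_uIcc Set.uIoc_subset_uIcc))
      _ ≤ ∫ _ in (0:ℝ)..1, ∫ t in (0:ℝ)..T, z (0, t) ⬝ᵥ R.mulVec (z (0, t)) := by
          refine intervalIntegral.integral_mono_on zero_le_one
            ((intervalIntegral.continuous_parametric_intervalIntegral_of_continuous'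
              hswap' 0 T).intervalIntegrable _ _)
            (continuous_const.intervalIntegrable _ _) fun x hx => ?_
          have hbal := transport_quadratic_balance R hz hpde hinit hx hT
          have hnonneg : 0 ≤ ∫ y in (0:ℝ)..x, z (y, T) ⬝ᵥ R.mulVec (z (y, T)) :=
            intervalIntegral.integral_nonneg hx.1 fun y _ => psd R hRpd _
          rw [← hbal] at hnonneg
          exact sub_nonneg.1 (nonneg_of_mul_nonneg_right hnonneg hρ)
      _ = ∫ t in (0:ℝ)..T, z (0, t) ⬝ᵥ R.mulVec (z (0, t)) := by simp
  linarith
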